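/- Let α ∈ (0,1) be irrational, ρ ∈ [0,1), let s = s_{α,ρ} be the Sturmian word of slope α and intercept ρ, and let ℓ ≥ 1. Then the first boundary set ∂_{s,ℓ}[ℓ] appears infinitely often in the ℓ-boundary sequence (∂_{s,ℓ}[n])_{n≥ℓ} if and only if 0^{2ℓ} or 1^{2ℓ} appears as a factor of s; otherwise it appears exactly once, i.e., ∂_{s,ℓ}[n] ≠ ∂_{s,ℓ}[ℓ] for all n > ℓ. -/

import Mathlib

/-- The Sturmian word of slope `α` and intercept `ρ`:
`s[n] = 0` iff `{ρ + nα} ∈ [0, 1−α)`. -/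
noncomputable def sturmian (α ρ : ℝ) (n : ℕ) : Fin 2 :=
  if Int.fract (ρ + n * α) < 1 - α then 0 else 1

/-- The `n`-th boundary set of the infinite word `x` with window length `ℓ`. -/
def boundarySet {A : Type*} (x : ℕ → A) (ℓ n : ℕ) :
    Set ((Fin ℓ → A) × (Fin ℓ → A)) :=
  {p | ∃ i : ℕ, (∀ k : Fin ℓ, p.1 k = x (i + k)) ∧ (∀ k : Fin ℓ, p.2 k = x (i + n + k))}

open Filter Topology

/-- Kronecker's theorem in one dimension, for multiples by large natural numbers. -/
theorem Irrational.exists_nat_mul_add_int_mem_Ioo {α : ℝ} (hα : Irrational α) {a b : ℝ}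
    (hab : a < b) (N : ℕ) : ∃ n ≥ N, ∃ m : ℤ, n * α + m ∈ Set.Ioo a b := by
  have hd : DenseRange (· • (α : AddCircle (1 : ℝ)) : ℕ → AddCircle (1 : ℝ)) := by
    rw [← denseRange_zsmul_iff_nsmul, AddCircle.denseRange_zsmul_coe_iff]
    simpa using hα
  obtain ⟨n, x, hx, hxn⟩ := hd.exists_mem_open
    (QuotientAddGroup.isOpenMap_coe (N := AddSubgroup.zmultiples (1 : ℝ)) _
      (isOpen_Ioo (a := a - N * α) (b := b - N * α)))
    ((Set.nonempty_Ioo.2 (by linarith)).image _)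
  change (x : AddCircle (1 : ℝ)) = n • (α : AddCircle (1 : ℝ)) at hxn
  rw [← AddCircle.coe_nsmul, ← sub_eq_zero, ← AddCircle.coe_sub, AddCircle.coe_eq_zero_iff] at hxn
  obtain ⟨m, hm⟩ := hxn
  simp only [nsmul_eq_mul, zsmul_eq_mul, mul_one] at hm
  refine ⟨n + N, by omega, m, ?_⟩
  have := hx.1
  have := hx.2
  push_cast
  constructor <;> linarith

theorem Irrational.fract_natCast_mul_pos {α : ℝ} (hα : Irrational α) {j : ℕ} (hj : 1 ≤ j) :
    0 < Int.fract (j * α) :=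
  Int.fract_pos.2 fun h => ((irrational_natCast_mul_iff.2 ⟨by omega, hα⟩).ne_int _) h

theorem boundarySet_subset_iff {A : Type*} {x : ℕ → A} {ℓ m n : ℕ} :
    boundarySet x ℓ m ⊆ boundarySet x ℓ n ↔
      ∀ i, ∃ i', (∀ k < ℓ, x (i' + k) = x (i + k)) ∧
        ∀ k < ℓ, x (i' + n + k) = x (i + m + k) := by
  constructor
  · intro h i
    obtain ⟨i', h1, h2⟩ := @h (fun k => x (i + k), fun k => x (i + m + k))
      ⟨i, fun _ => rfl, fun _ => rfl⟩
    exact ⟨i', fun k hk => (h1 ⟨k, hk⟩).symm, fun k hk => (h2 ⟨k, hk⟩).symm⟩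
  · rintro h p ⟨i, h1, h2⟩
    obtain ⟨i', h3, h4⟩ := h i
    exact ⟨i', fun k => (h1 k).trans (h3 k k.2).symm, fun k => (h2 k).trans (h4 k k.2).symm⟩

theorem boundarySet_subset_of_constant_block {A : Type*} {x : ℕ → A} {ℓ n : ℕ} {c : A}
    (hn : ℓ ≤ n) (hc : ∃ i, ∀ k < 2 * ℓ, x (i + k) = c)
    (h : ∀ i, ((∀ k < ℓ, x (i + k) = c) ∧ ∀ k < ℓ, x (i + n + k) = c) ∨
      ((∀ k < ℓ, x (i + n + k) = c) ∧ ∀ k < ℓ, x (i + ℓ + k) = c) ∨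
      ((∀ k < ℓ, x (i + k) = c) ∧ ∀ k < ℓ, x (i + n - ℓ + k) = c)) :
    boundarySet x ℓ n ⊆ boundarySet x ℓ ℓ := by
  rw [boundarySet_subset_iff]
  intro i
  rcases h i with ⟨h1, h2⟩ | ⟨h1, h2⟩ | ⟨h1, h2⟩
  · obtain ⟨i', hi'⟩ := hc
    refine ⟨i', fun k hk => ?_, fun k hk => ?_⟩
    · rw [h1 k hk, hi' k (by omega)]
    · rw [h2 k hk, add_assoc, hi' _ (by omega)]
  · exact ⟨i, fun _ _ => rfl, fun k hk => by rw [h1 k hk, h2 k hk]⟩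
  · refine ⟨i + n - ℓ, fun k hk => by rw [h1 k hk, h2 k hk], fun k _ => ?_⟩
    congr 2
    omega

section Sturmian

variable {α ρ : ℝ}

theorem sturmian_val (hα0 : 0 < α) (hα1 : α < 1) (i : ℕ) :
    ((sturmian α ρ i).val : ℤ) = ⌊ρ + (i + 1 : ℕ) * α⌋ - ⌊ρ + i * α⌋ := by
  have h0 := Int.fract_nonneg (ρ + i * α)
  have h1 := Int.fract_lt_one (ρ + i * α)
  have h2 := Int.floor_add_fract (ρ + i * α)
  rw [eq_sub_iff_add_eq, eq_comm, Int.floor_eq_iff]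
  unfold sturmian
  split_ifs with h
  · push_cast [Fin.val_zero]
    constructor <;> linarith
  · push_cast [Fin.val_one]
    constructor <;> linarith

theorem sum_sturmian_val (hα0 : 0 < α) (hα1 : α < 1) (i L : ℕ) :
    ∑ k ∈ Finset.range L, ((sturmian α ρ (i + k)).val : ℤ) =
      ⌊ρ + (i + L : ℕ) * α⌋ - ⌊ρ + i * α⌋ := by
  simp only [sturmian_val hα0 hα1]
  exact Finset.sum_range_sub (fun k => ⌊ρ + (i + k : ℕ) * α⌋) L

theorem sturmian_eq_zero_iff (hα0 : 0 < α) (hα1 : α < 1) (i L : ℕ) :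
    (∀ k < L, sturmian α ρ (i + k) = 0) ↔ Int.fract (ρ + i * α) + L * α < 1 := by
  have hs := sum_sturmian_val (ρ := ρ) hα0 hα1 i L
  have h2 := Int.floor_add_fract (ρ + i * α)
  have h0 := Int.fract_nonneg (ρ + i * α)
  have hL : 0 ≤ L * α := by positivity
  trans ⌊ρ + (i + L : ℕ) * α⌋ - ⌊ρ + i * α⌋ = 0
  · rw [← hs, Finset.sum_eq_zero_iff_of_nonneg fun _ _ => by positivity]
    simp only [Finset.mem_range, Nat.cast_eq_zero, Fin.ext_iff, Fin.val_zero]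
  · rw [sub_eq_zero, Int.floor_eq_iff]
    push_cast
    constructor
    · rintro ⟨-, h⟩
      linarith
    · intro h
      constructor <;> linarith

theorem sturmian_eq_one_iff (hα0 : 0 < α) (hα1 : α < 1) (i L : ℕ) :
    (∀ k < L, sturmian α ρ (i + k) = 1) ↔ L * (1 - α) ≤ Int.fract (ρ + i * α) := by
  have hs := sum_sturmian_val (ρ := ρ) hα0 hα1 i L
  have h2 := Int.floor_add_fract (ρ + i * α)
  have h1 := Int.fract_lt_one (ρ + i * α)
  have hL : 0 ≤ L * (1 - α) := mul_nonneg (by positivity) (by linarith)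
  trans ⌊ρ + (i + L : ℕ) * α⌋ = ⌊ρ + i * α⌋ + L
  · have hs' : ∑ k ∈ Finset.range L, (1 - ((sturmian α ρ (i + k)).val : ℤ)) =
        L - (⌊ρ + (i + L : ℕ) * α⌋ - ⌊ρ + i * α⌋) := by
      rw [Finset.sum_sub_distrib, hs]
      simp
    trans ∑ k ∈ Finset.range L, (1 - ((sturmian α ρ (i + k)).val : ℤ)) = 0
    · rw [Finset.sum_eq_zero_iff_of_nonneg fun k _ => by have := (sturmian α ρ (i + k)).2; omega]
      simp only [Finset.mem_range, Fin.ext_iff, Fin.val_one]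
      exact forall₂_congr fun k _ => by omega
    · rw [hs']
      omega
  · rw [Int.floor_eq_iff]
    push_cast
    constructor
    · rintro ⟨h, -⟩
      linarith
    · intro h
      constructor <;> linarith

theorem exists_orbit_mem_Ioo (hirr : Irrational α) {a b : ℝ} (hab : a < b) (N : ℕ) :
    ∃ n ≥ N, ∃ m : ℤ, ρ + n * α + m ∈ Set.Ioo a b := by
  obtain ⟨n, hn, m, h1, h2⟩ := hirr.exists_nat_mul_add_int_mem_Ioo
    (a := a - ρ) (b := b - ρ) (by linarith) N
  exact ⟨n, hn, m, by linarith, by linarith⟩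

theorem exists_sturmian_eq_zero_iff (hα0 : 0 < α) (hα1 : α < 1) (hirr : Irrational α) (L : ℕ) :
    (∃ i, ∀ k < L, sturmian α ρ (i + k) = 0) ↔ L * α < 1 := by
  simp only [sturmian_eq_zero_iff hα0 hα1]
  constructor
  · rintro ⟨i, h⟩
    linarith [Int.fract_nonneg (ρ + i * α)]
  · intro h
    obtain ⟨n, -, m, h1, h2⟩ := exists_orbit_mem_Ioo (ρ := ρ) hirr (sub_pos.2 h) 0
    have hL : 0 ≤ L * α := by positivity
    refine ⟨n, ?_⟩
    rw [← Int.fract_add_intCast _ m, Int.fract_eq_self.2 ⟨h1.le, by linarith⟩]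
    linarith

theorem exists_sturmian_eq_one_iff (hα0 : 0 < α) (hα1 : α < 1) (hirr : Irrational α) (L : ℕ) :
    (∃ i, ∀ k < L, sturmian α ρ (i + k) = 1) ↔ L * (1 - α) < 1 := by
  simp only [sturmian_eq_one_iff hα0 hα1]
  constructor
  · rintro ⟨i, h⟩
    linarith [Int.fract_lt_one (ρ + i * α)]
  · intro h
    obtain ⟨n, -, m, h1, h2⟩ := exists_orbit_mem_Ioo (ρ := ρ) hirr h 0
    have hL : 0 ≤ L * (1 - α) := mul_nonneg (by positivity) (by linarith)
    refine ⟨n, ?_⟩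
    rw [← Int.fract_add_intCast _ m, Int.fract_eq_self.2 ⟨by linarith, h2⟩]
    exact h1.le

theorem floor_sub_eq_of_sturmian_eq (hα0 : 0 < α) (hα1 : α < 1) {ℓ i i' : ℕ}
    (h : ∀ k < ℓ, sturmian α ρ (i' + k) = sturmian α ρ (i + k)) {j : ℕ} (hj : j ≤ ℓ) :
    ⌊ρ + (i' + j : ℕ) * α⌋ - ⌊ρ + i' * α⌋ = ⌊ρ + (i + j : ℕ) * α⌋ - ⌊ρ + i * α⌋ := by
  rw [← sum_sturmian_val hα0 hα1, ← sum_sturmian_val hα0 hα1]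
  refine Finset.sum_congr rfl fun k hk => ?_
  rw [h k (by have := Finset.mem_range.1 hk; omega)]

theorem one_le_fract_add_fract_iff (x t : ℝ) :
    1 ≤ Int.fract x + Int.fract t ↔ ⌊x + t⌋ - ⌊x⌋ = ⌊t⌋ + 1 := by
  have := Int.floor_add_fract x
  have := Int.floor_add_fract t
  have := Int.fract_lt_one x
  have := Int.fract_lt_one t
  rw [sub_eq_iff_eq_add, Int.floor_eq_iff]
  push_cast
  constructor
  · intro h
    constructor <;> linarith
  · rintro ⟨h, -⟩
    linarith

theorem fract_le_fract_iff_floor_sub (x t : ℝ) :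
    Int.fract t ≤ Int.fract x ↔ ⌊x⌋ - ⌊x - t⌋ = ⌊t⌋ := by
  have := Int.floor_add_fract x
  have := Int.floor_add_fract t
  have := Int.fract_lt_one x
  have := Int.fract_nonneg t
  rw [sub_eq_iff_eq_add, ← sub_eq_iff_eq_add', eq_comm, Int.floor_eq_iff]
  push_cast
  constructor
  · intro h
    constructor <;> linarith
  · rintro ⟨h, -⟩
    linarith

theorem one_le_fract_add_fract_congr (hα0 : 0 < α) (hα1 : α < 1) {ℓ i i' : ℕ}
    (h : ∀ k < ℓ, sturmian α ρ (i' + k) = sturmian α ρ (i + k)) {j : ℕ} (hj : j ≤ ℓ) :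
    1 ≤ Int.fract (ρ + i' * α) + Int.fract (j * α) ↔
      1 ≤ Int.fract (ρ + i * α) + Int.fract (j * α) := by
  have := floor_sub_eq_of_sturmian_eq hα0 hα1 h hj
  rw [one_le_fract_add_fract_iff, one_le_fract_add_fract_iff]
  push_cast at this
  rw [add_assoc, ← add_mul, add_assoc, ← add_mul, this]

theorem fract_le_fract_congr (hα0 : 0 < α) (hα1 : α < 1) {ℓ i i' : ℕ}
    (h : ∀ k < ℓ, sturmian α ρ (i' + k) = sturmian α ρ (i + k)) {j : ℕ} (hj : j ≤ ℓ) :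
    Int.fract (j * α) ≤ Int.fract (ρ + (i' + ℓ : ℕ) * α) ↔
      Int.fract (j * α) ≤ Int.fract (ρ + (i + ℓ : ℕ) * α) := by
  have h1 := floor_sub_eq_of_sturmian_eq hα0 hα1 h le_rfl
  have h2 := floor_sub_eq_of_sturmian_eq hα0 hα1 h (Nat.sub_le ℓ j)
  have h3 (i : ℕ) : ρ + (i + ℓ : ℕ) * α - j * α = ρ + (i + (ℓ - j) : ℕ) * α := by
    push_cast [Nat.cast_sub hj]
    ring
  rw [fract_le_fract_iff_floor_sub, fract_le_fract_iff_floor_sub, h3, h3]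
  omega

theorem nat_mul_lt_half_of_fract_lt_half (hα0 : 0 < α) (hα1 : α < 1) {ℓ : ℕ}
    (h : ∀ j, 1 ≤ j → j ≤ ℓ → Int.fract (j * α) < 1 / 2) : ℓ * α < 1 / 2 := by
  induction ℓ with
  | zero => norm_num
  | succ ℓ ih =>
    have h1 := h 1 le_rfl (by omega)
    have h2 := ih fun j hj hj' => h j hj (by omega)
    have h3 := h (ℓ + 1) (by omega) le_rfl
    rw [Nat.cast_one, one_mul, Int.fract_eq_self.2 ⟨hα0.le, hα1⟩] at h1
    push_cast at h3 ⊢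
    rwa [Int.fract_eq_self.2 ⟨by positivity, by linarith⟩] at h3

theorem fract_lt_half_or_of_boundarySet_eq (hα0 : 0 < α) (hα1 : α < 1) (hirr : Irrational α)
    {ℓ n : ℕ} (hn : ℓ < n)
    (h : boundarySet (sturmian α ρ) ℓ n = boundarySet (sturmian α ρ) ℓ ℓ) :
    (∀ j, 1 ≤ j → j ≤ ℓ → Int.fract (j * α) < 1 / 2) ∨
      ∀ j, 1 ≤ j → j ≤ ℓ → 1 / 2 < Int.fract (j * α) := by
  obtain ⟨ε, hε, hε0⟩ : ∃ ε : ℝ, (∀ j ∈ Finset.Icc 1 ℓ, ε < Int.fract (j * α) ∧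
      ε < 1 - Int.fract (j * α)) ∧ 0 < ε := by
    have : ∀ᶠ ε : ℝ in 𝓝[>] 0, ∀ j ∈ Finset.Icc 1 ℓ, ε < Int.fract (j * α) ∧
        ε < 1 - Int.fract (j * α) := by
      rw [eventually_all_finset]
      intro j hj
      refine nhdsWithin_le_nhds ((eventually_lt_nhds ?_).and (eventually_lt_nhds ?_))
      · exact hirr.fract_natCast_mul_pos (Finset.mem_Icc.1 hj).1
      · exact sub_pos.2 (Int.fract_lt_one _)
    exact (this.and self_mem_nhdsWithin).exists
  replace hε (j : ℕ) (h1 : 1 ≤ j) (h2 : j ≤ ℓ) := hε j (Finset.mem_Icc.2 ⟨h1, h2⟩)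
  obtain ⟨i₀, hi₀, m₀, h1, h2⟩ := exists_orbit_mem_Ioo (ρ := ρ) hirr
    (show max (1 - ε) 0 < 1 by simp [hε0]) ℓ
  obtain ⟨i₀, rfl⟩ := Nat.exists_eq_add_of_le' hi₀
  have h3 : Int.fract (ρ + (i₀ + ℓ : ℕ) * α) = ρ + (i₀ + ℓ : ℕ) * α + m₀ := by
    rw [← Int.fract_add_intCast _ m₀]
    exact Int.fract_eq_self.2 ⟨(le_max_right _ _).trans h1.le, h2⟩
  rw [← h3] at h1
  replace h1 := (le_max_left _ _).trans_lt h1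
  obtain ⟨i, hi1, hi2⟩ := boundarySet_subset_iff.1 h.ge i₀
  have hy (j : ℕ) (hj1 : 1 ≤ j) (hj2 : j ≤ ℓ) :
      Int.fract (j * α) ≤ Int.fract (ρ + (i + ℓ : ℕ) * α) :=
    (fract_le_fract_congr hα0 hα1 hi1 hj2).2 (by linarith [hε j hj1 hj2])
  have hz (j : ℕ) (hj1 : 1 ≤ j) (hj2 : j ≤ ℓ) :
      1 ≤ Int.fract (ρ + (i + n : ℕ) * α) + Int.fract (j * α) :=
    (one_le_fract_add_fract_congr hα0 hα1 hi2 hj2).2 (by linarith [hε j hj1 hj2])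
  have hyz : Int.fract (ρ + (i + ℓ : ℕ) * α) ≠ Int.fract (ρ + (i + n : ℕ) * α) := by
    rw [Ne, Int.fract_eq_fract]
    rintro ⟨z, hz⟩
    refine (irrational_natCast_mul_iff.2 ⟨show n - ℓ ≠ 0 by omega, hirr⟩).ne_int (-z) ?_
    push_cast [Nat.cast_sub hn.le] at hz ⊢
    linarith
  have hy1 := Int.fract_lt_one (ρ + (i + ℓ : ℕ) * α)
  have hz1 := Int.fract_lt_one (ρ + (i + n : ℕ) * α)
  have hy0 := Int.fract_nonneg (ρ + (i + ℓ : ℕ) * α)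
  have hz0 := Int.fract_nonneg (ρ + (i + n : ℕ) * α)
  have hy2 := Int.floor_add_fract (ρ + (i + ℓ : ℕ) * α)
  have hz2 := Int.floor_add_fract (ρ + (i + n : ℕ) * α)
  generalize Int.fract (ρ + (i + ℓ : ℕ) * α) = y at *
  generalize Int.fract (ρ + (i + n : ℕ) * α) = z at *
  generalize ⌊ρ + (i + ℓ : ℕ) * α⌋ = fy at *
  generalize ⌊ρ + (i + n : ℕ) * α⌋ = fz at *
  push_cast at hy2 hz2
  rcases lt_or_gt_of_ne hyz with hlt | hlt
  · left
    obtain ⟨i', -, m, h4, h5⟩ := exists_orbit_mem_Ioo (ρ := ρ) hirr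
      (show ρ + i * α + (1 - z) < ρ + i * α + (1 - z) + min ε (z - y) by
        have := lt_min hε0 (sub_pos.2 hlt)
        linarith) 0
    have := min_le_left ε (z - y)
    have := min_le_right ε (z - y)
    have hy' : Int.fract (ρ + (i' + ℓ : ℕ) * α) =
        y + (ρ + i' * α + m - (ρ + i * α)) := by
      rw [Int.fract_eq_iff]
      refine ⟨by linarith, by linarith, fy - m, ?_⟩
      push_cast
      linarith
    have hz' : Int.fract (ρ + (i' + n : ℕ) * α) =
        z + (ρ + i' * α + m - (ρ + i * α)) - 1 := by
      rw [Int.fract_eq_iff]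
      refine ⟨by linarith, by linarith, fz - m + 1, ?_⟩
      push_cast
      linarith
    obtain ⟨i'', h6, h7⟩ := boundarySet_subset_iff.1 h.le i'
    intro j hj1 hj2
    have h8 := (fract_le_fract_congr hα0 hα1 h6 hj2).2 (by linarith [hy j hj1 hj2])
    have h9 := (one_le_fract_add_fract_congr hα0 hα1 h7 hj2).not.2
      (by linarith [hε j hj1 hj2])
    linarith
  · right
    obtain ⟨i', -, m, h4, h5⟩ := exists_orbit_mem_Ioo (ρ := ρ) hirr
      (show ρ + i * α + (1 - y) < ρ + i * α + (1 - y) + min ε (y - z) by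
        have := lt_min hε0 (sub_pos.2 hlt)
        linarith) 0
    have := min_le_left ε (y - z)
    have := min_le_right ε (y - z)
    have hy' : Int.fract (ρ + (i' + ℓ : ℕ) * α) =
        y + (ρ + i' * α + m - (ρ + i * α)) - 1 := by
      rw [Int.fract_eq_iff]
      refine ⟨by linarith, by linarith, fy - m + 1, ?_⟩
      push_cast
      linarith
    have hz' : Int.fract (ρ + (i' + n : ℕ) * α) =
        z + (ρ + i' * α + m - (ρ + i * α)) := by
      rw [Int.fract_eq_iff]
      refine ⟨by linarith, by linarith, fz - m, ?_⟩
      push_cast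
      linarith
    obtain ⟨i'', h6, h7⟩ := boundarySet_subset_iff.1 h.le i'
    intro j hj1 hj2
    have h8 := (fract_le_fract_congr hα0 hα1 h6 hj2).not.2 (by linarith [hε j hj1 hj2])
    have h9 := (one_le_fract_add_fract_congr hα0 hα1 h7 hj2).2 (by linarith [hz j hj1 hj2])
    linarith

theorem exists_constant_block_of_boundarySet_eq (hα0 : 0 < α) (hα1 : α < 1)
    (hirr : Irrational α) {ℓ n : ℕ} (hn : ℓ < n)
    (h : boundarySet (sturmian α ρ) ℓ n = boundarySet (sturmian α ρ) ℓ ℓ) :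
    (∃ i, ∀ j < 2 * ℓ, sturmian α ρ (i + j) = 0) ∨
      ∃ i, ∀ j < 2 * ℓ, sturmian α ρ (i + j) = 1 := by
  rw [exists_sturmian_eq_zero_iff hα0 hα1 hirr, exists_sturmian_eq_one_iff hα0 hα1 hirr]
  push_cast
  refine (fract_lt_half_or_of_boundarySet_eq hα0 hα1 hirr hn h).imp (fun h => ?_) fun h => ?_
  · linarith [nat_mul_lt_half_of_fract_lt_half hα0 hα1 h]
  · suffices ℓ * (1 - α) < 1 / 2 by linarith
    refine nat_mul_lt_half_of_fract_lt_half (by linarith) (by linarith) fun j hj1 hj2 => ?_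
    rw [show (j : ℝ) * (1 - α) = -(j * α) + (j : ℤ) by push_cast; ring, Int.fract_add_intCast,
      Int.fract_neg (hirr.fract_natCast_mul_pos hj1).ne']
    linarith [h j hj1 hj2]

/-- Each orbit point can be replaced by one whose coding of length `L` is the same and is
stable under small perturbations in both directions. -/
theorem exists_stable_orbit (hirr : Irrational α) (i L : ℕ) :
    ∃ i' : ℕ, ∃ m : ℤ, ∃ δ > 0, ∀ η, |η| < δ → ∀ k ≤ L,
      ⌊ρ + (i' + k : ℕ) * α + η⌋ = ⌊ρ + (i + k : ℕ) * α⌋ + m := by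
  obtain ⟨δ, hδ, hδ0⟩ : ∃ δ : ℝ, (∀ k ∈ Finset.range (L + 1),
      δ < 1 - Int.fract (ρ + (i + k : ℕ) * α)) ∧ 0 < δ := by
    have : ∀ᶠ δ : ℝ in 𝓝[>] 0, ∀ k ∈ Finset.range (L + 1),
        δ < 1 - Int.fract (ρ + (i + k : ℕ) * α) := by
      rw [eventually_all_finset]
      exact fun k _ => nhdsWithin_le_nhds
        (eventually_lt_nhds (sub_pos.2 (Int.fract_lt_one _)))
    exact (this.and self_mem_nhdsWithin).exists
  obtain ⟨i', -, m, h1, h2⟩ := exists_orbit_mem_Ioo (ρ := ρ) hirr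
    (show ρ + i * α < ρ + i * α + δ by linarith) 0
  refine ⟨i', -m, min (ρ + i' * α + m - (ρ + i * α)) (ρ + i * α + δ - (ρ + i' * α + m)),
    lt_min (by linarith) (by linarith), fun η hη k hk => ?_⟩
  obtain ⟨h3, h4⟩ := abs_lt.1 hη
  have := hδ k (Finset.mem_range.2 (by omega))
  have := Int.floor_add_fract (ρ + (i + k : ℕ) * α)
  have := Int.fract_nonneg (ρ + (i + k : ℕ) * α)
  have := min_le_left (ρ + i' * α + m - (ρ + i * α)) (ρ + i * α + δ - (ρ + i' * α + m))
  have := min_le_right (ρ + i' * α + m - (ρ + i * α)) (ρ + i * α + δ - (ρ + i' * α + m))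
  rw [Int.floor_eq_iff]
  push_cast at *
  constructor <;> linarith

theorem sturmian_eq_of_floor_eq (hα0 : 0 < α) (hα1 : α < 1) {i i' ℓ : ℕ} {m : ℤ}
    (h : ∀ k ≤ ℓ, ⌊ρ + (i' + k : ℕ) * α⌋ = ⌊ρ + (i + k : ℕ) * α⌋ + m) (k : ℕ) (hk : k < ℓ) :
    sturmian α ρ (i' + k) = sturmian α ρ (i + k) := by
  have h1 := sturmian_val (ρ := ρ) hα0 hα1 (i' + k)
  have h2 := sturmian_val (ρ := ρ) hα0 hα1 (i + k)
  rw [add_assoc, h _ hk.le, h (k + 1) hk] at h1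
  rw [add_assoc] at h2
  rw [Fin.ext_iff]
  omega

theorem exists_boundarySet_subset (hα0 : 0 < α) (hα1 : α < 1) (hirr : Irrational α) (ℓ : ℕ) :
    ∃ δ > 0, ∀ n : ℕ, ∀ m : ℤ, |n * α + m - ℓ * α| < δ →
      boundarySet (sturmian α ρ) ℓ ℓ ⊆ boundarySet (sturmian α ρ) ℓ n := by
  have key : ∀ p ∈ boundarySet (sturmian α ρ) ℓ ℓ, ∀ᶠ δ in 𝓝[>] (0 : ℝ), ∀ n : ℕ, ∀ m : ℤ,
      |n * α + m - ℓ * α| < δ → p ∈ boundarySet (sturmian α ρ) ℓ n := by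
    rintro p ⟨i, hp1, hp2⟩
    obtain ⟨i', c, δ, hδ, h⟩ := exists_stable_orbit (ρ := ρ) hirr i (2 * ℓ)
    filter_upwards [nhdsWithin_le_nhds (eventually_lt_nhds hδ)] with δ' hδ' n m hnm
    have h1 := sturmian_eq_of_floor_eq (ℓ := ℓ) hα0 hα1 (i := i) (i' := i') (m := c)
      fun k hk => by simpa using h 0 (by simpa using hδ) k (by omega)
    have h2 := sturmian_eq_of_floor_eq (ℓ := ℓ) hα0 hα1 (i := i + ℓ) (i' := i' + n) (m := c - m)
      fun k hk => by
        have := h _ (hnm.trans hδ') (ℓ + k) (by omega)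
        rw [← add_assoc i] at this
        rw [← add_sub_assoc, ← this, eq_sub_iff_add_eq, ← Int.floor_add_intCast]
        push_cast
        congr 1
        ring
    exact ⟨i', fun k => (hp1 k).trans (h1 k k.2).symm, fun k => (hp2 k).trans (h2 k k.2).symm⟩
  obtain ⟨δ, h, hδ⟩ := (((eventually_all_finite (Set.toFinite _)).2 key).and
    self_mem_nhdsWithin).exists
  exact ⟨δ, hδ, fun n m hnm p hp => h p hp n m hnm⟩

theorem boundarySet_subset_of_zero_block (hα0 : 0 < α) (hα1 : α < 1) (hirr : Irrational α)
    {ℓ n : ℕ} (hn : ℓ ≤ n) (hℓ : (2 * ℓ : ℕ) * α < 1) {m : ℤ} (h0 : 0 < n * α + m - ℓ * α)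
    (h1 : n * α + m - ℓ * α < 1 - (2 * ℓ : ℕ) * α) :
    boundarySet (sturmian α ρ) ℓ n ⊆ boundarySet (sturmian α ρ) ℓ ℓ := by
  refine boundarySet_subset_of_constant_block hn
    ((exists_sturmian_eq_zero_iff hα0 hα1 hirr _).2 hℓ) fun i => ?_
  simp only [sturmian_eq_zero_iff hα0 hα1]
  have hf0 := Int.fract_nonneg (ρ + (i + ℓ : ℕ) * α)
  have hf1 := Int.fract_lt_one (ρ + (i + ℓ : ℕ) * α)
  have hf := Int.floor_add_fract (ρ + (i + ℓ : ℕ) * α)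
  generalize Int.fract (ρ + (i + ℓ : ℕ) * α) = f at *
  generalize ⌊ρ + (i + ℓ : ℕ) * α⌋ = c at *
  have hL : 0 ≤ ℓ * α := by positivity
  push_cast at hℓ h1 hf
  have hi (h : ℓ * α ≤ f) : Int.fract (ρ + i * α) = f - ℓ * α := by
    rw [Int.fract_eq_iff]
    exact ⟨by linarith, by linarith, c, by linarith⟩
  rcases le_or_gt 1 (f + (n * α + m - ℓ * α)) with h2 | h2
  · left
    have : Int.fract (ρ + (i + n : ℕ) * α) = f + (n * α + m - ℓ * α) - 1 := by
      rw [Int.fract_eq_iff]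
      refine ⟨by linarith, by linarith, c - m + 1, ?_⟩
      push_cast
      linarith
    rw [this, hi (by linarith)]
    constructor <;> linarith
  have hin : Int.fract (ρ + (i + n : ℕ) * α) = f + (n * α + m - ℓ * α) := by
    rw [Int.fract_eq_iff]
    refine ⟨by linarith, by linarith, c - m, ?_⟩
    push_cast
    linarith
  right
  rcases lt_or_ge (f + (n * α + m - ℓ * α) + ℓ * α) 1 with h3 | h3
  · left
    rw [hin]
    constructor <;> linarith
  · right
    have : Int.fract (ρ + (i + n - ℓ : ℕ) * α) = f + (n * α + m - ℓ * α) - ℓ * α := by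
      rw [Int.fract_eq_iff]
      refine ⟨by linarith, by linarith, c - m, ?_⟩
      push_cast [Nat.cast_sub (show ℓ ≤ i + n by omega)]
      linarith
    rw [this, hi (by linarith)]
    constructor <;> linarith

theorem boundarySet_subset_of_one_block (hα0 : 0 < α) (hα1 : α < 1) (hirr : Irrational α)
    {ℓ n : ℕ} (hn : ℓ ≤ n) (hℓ : (2 * ℓ : ℕ) * (1 - α) < 1) {m : ℤ}
    (h0 : n * α + m - ℓ * α < 0) (h1 : (2 * ℓ : ℕ) * (1 - α) - 1 < n * α + m - ℓ * α) :
    boundarySet (sturmian α ρ) ℓ n ⊆ boundarySet (sturmian α ρ) ℓ ℓ := by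
  refine boundarySet_subset_of_constant_block hn
    ((exists_sturmian_eq_one_iff hα0 hα1 hirr _).2 hℓ) fun i => ?_
  simp only [sturmian_eq_one_iff hα0 hα1]
  have hf0 := Int.fract_nonneg (ρ + (i + ℓ : ℕ) * α)
  have hf1 := Int.fract_lt_one (ρ + (i + ℓ : ℕ) * α)
  have hf := Int.floor_add_fract (ρ + (i + ℓ : ℕ) * α)
  generalize Int.fract (ρ + (i + ℓ : ℕ) * α) = f at *
  generalize ⌊ρ + (i + ℓ : ℕ) * α⌋ = c at *
  have hL : 0 ≤ ℓ * (1 - α) := mul_nonneg (by positivity) (by linarith)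
  push_cast at hℓ h1 hf
  have hi (h : f + ℓ * (1 - α) < 1) : Int.fract (ρ + i * α) = f + ℓ * (1 - α) := by
    rw [Int.fract_eq_iff]
    refine ⟨by linarith, by linarith, c - ℓ, ?_⟩
    push_cast
    linarith
  rcases lt_or_ge (f + (n * α + m - ℓ * α)) 0 with h2 | h2
  · left
    have : Int.fract (ρ + (i + n : ℕ) * α) = f + (n * α + m - ℓ * α) + 1 := by
      rw [Int.fract_eq_iff]
      refine ⟨by linarith, by linarith, c - m - 1, ?_⟩
      push_cast
      linarith
    rw [this, hi (by linarith)]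
    constructor <;> linarith
  have hin : Int.fract (ρ + (i + n : ℕ) * α) = f + (n * α + m - ℓ * α) := by
    rw [Int.fract_eq_iff]
    refine ⟨by linarith, by linarith, c - m, ?_⟩
    push_cast
    linarith
  right
  rcases le_or_gt (ℓ * (1 - α)) (f + (n * α + m - ℓ * α)) with h3 | h3
  · left
    rw [hin]
    constructor <;> linarith
  · right
    have : Int.fract (ρ + (i + n - ℓ : ℕ) * α) =
        f + (n * α + m - ℓ * α) + ℓ * (1 - α) := by
      rw [Int.fract_eq_iff]
      refine ⟨by linarith, by linarith, c - m - ℓ, ?_⟩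
      push_cast [Nat.cast_sub (show ℓ ≤ i + n by omega)]
      linarith
    rw [this, hi (by linarith)]
    constructor <;> linarith

theorem infinite_boundarySet_eq (hα0 : 0 < α) (hα1 : α < 1) (hirr : Irrational α) {ℓ : ℕ}
    (h : (∃ i, ∀ j < 2 * ℓ, sturmian α ρ (i + j) = 0) ∨
      ∃ i, ∀ j < 2 * ℓ, sturmian α ρ (i + j) = 1) :
    {n : ℕ | ℓ ≤ n ∧
      boundarySet (sturmian α ρ) ℓ n = boundarySet (sturmian α ρ) ℓ ℓ}.Infinite := by
  rw [exists_sturmian_eq_zero_iff hα0 hα1 hirr, exists_sturmian_eq_one_iff hα0 hα1 hirr] at h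
  obtain ⟨δ, hδ, hsub⟩ := exists_boundarySet_subset (ρ := ρ) hα0 hα1 hirr ℓ
  refine Set.infinite_of_forall_exists_gt fun N => ?_
  rcases h with h | h
  · obtain ⟨n, hn, m, h1, h2⟩ := hirr.exists_nat_mul_add_int_mem_Ioo
      (show ℓ * α < ℓ * α + min δ (1 - (2 * ℓ : ℕ) * α) by
        have := lt_min hδ (sub_pos.2 h)
        linarith) (N + 1 + ℓ)
    have := min_le_left δ (1 - (2 * ℓ : ℕ) * α)
    have := min_le_right δ (1 - (2 * ℓ : ℕ) * α)
    refine ⟨n, ⟨by omega, (boundarySet_subset_of_zero_block hα0 hα1 hirr (by omega) h (m := m)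
      (by linarith) (by linarith)).antisymm (hsub n m ?_)⟩, by omega⟩
    rw [abs_lt]
    constructor <;> linarith
  · obtain ⟨n, hn, m, h1, h2⟩ := hirr.exists_nat_mul_add_int_mem_Ioo
      (show ℓ * α - min δ (1 - (2 * ℓ : ℕ) * (1 - α)) < ℓ * α by
        have := lt_min hδ (sub_pos.2 h)
        linarith) (N + 1 + ℓ)
    have := min_le_left δ (1 - (2 * ℓ : ℕ) * (1 - α))
    have := min_le_right δ (1 - (2 * ℓ : ℕ) * (1 - α))
    refine ⟨n, ⟨by omega, (boundarySet_subset_of_one_block hα0 hα1 hirr (by omega) h (m := m)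
      (by linarith) (by linarith)).antisymm (hsub n m ?_)⟩, by omega⟩
    rw [abs_lt]
    constructor <;> linarith

end Sturmian

/-- for a Sturmian word `s` of irrational slope `α ∈ (0,1)` and intercept
`ρ`, and `ℓ ≥ 1`, the first boundary set `∂_{s,ℓ}[ℓ]` appears infinitely often in
`(∂_{s,ℓ}[n])_{n ≥ ℓ}` iff `0^{2ℓ}` or `1^{2ℓ}` occurs in `s`; otherwise it appears
exactly once. -/
theorem stmt13 (α : ℝ) (hα0 : 0 < α) (hα1 : α < 1) (hirr : Irrational α)
    (ρ : ℝ) (hρ0 : 0 ≤ ρ) (hρ1 : ρ < 1) (ℓ : ℕ) (hℓ : 1 ≤ ℓ) :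
    ({n : ℕ | ℓ ≤ n ∧
        boundarySet (sturmian α ρ) ℓ n = boundarySet (sturmian α ρ) ℓ ℓ}.Infinite ↔
      ((∃ i : ℕ, ∀ j < 2 * ℓ, sturmian α ρ (i + j) = 0) ∨
        (∃ i : ℕ, ∀ j < 2 * ℓ, sturmian α ρ (i + j) = 1))) ∧
    (¬ ((∃ i : ℕ, ∀ j < 2 * ℓ, sturmian α ρ (i + j) = 0) ∨
        (∃ i : ℕ, ∀ j < 2 * ℓ, sturmian α ρ (i + j) = 1)) →
      ∀ n : ℕ, ℓ < n →
        boundarySet (sturmian α ρ) ℓ n ≠ boundarySet (sturmian α ρ) ℓ ℓ) := by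
  refine ⟨⟨fun h => ?_, infinite_boundarySet_eq hα0 hα1 hirr⟩, fun h n hn heq =>
    h (exists_constant_block_of_boundarySet_eq hα0 hα1 hirr hn heq)⟩
  obtain ⟨n, ⟨-, heq⟩, hn⟩ := h.exists_gt ℓ
  exact exists_constant_block_of_boundarySet_eq hα0 hα1 hirr hn heq
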